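/- Let Γ be a finite directed graph and F a field. The Leavitt path algebra L(Γ) has polynomially bounded growth if and only if any two distinct cycles of Γ have no common vertex. -/

import Mathlib

open scoped BigOperators

section LeavittSetup

variable {V E : Type}

/-- Generators of the Leavitt path algebra of a graph: vertices, edges, and ghost (star) edges. -/
inductive LGen (V E : Type) : Type
  | vert : V → LGen V E
  | edge : E → LGen V E
  | star : E → LGen V E

variable (F : Type) [Field F]

/-- The vertex generator inside the free algebra. -/
noncomputable def gvert (v : V) : FreeAlgebra F (LGen V E) := FreeAlgebra.ι F (LGen.vert v)

/-- The edge generator inside the free algebra. -/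
noncomputable def gedge (e : E) : FreeAlgebra F (LGen V E) := FreeAlgebra.ι F (LGen.edge e)

/-- The ghost edge generator `e*` inside the free algebra. -/
noncomputable def gstar (e : E) : FreeAlgebra F (LGen V E) := FreeAlgebra.ι F (LGen.star e)

variable (s r : E → V)

/-- The defining relations of the Leavitt path algebra of the graph `(V, E, s, r)`:
(1) `v * w = δ_{v,w} v`; (2) `s(e) e = e = e r(e)` and `r(e) e* = e* = e* s(e)`;
(3) `e* f = δ_{e,f} r(e)`; (4) `v = ∑_{s(e) = v} e e*` for every non-sink `v`
(the sum makes sense whenever `v` emits finitely many edges, in particular for a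
row-finite graph). -/
inductive LeavittRel : FreeAlgebra F (LGen V E) → FreeAlgebra F (LGen V E) → Prop
  | vertSelf (v : V) : LeavittRel (gvert F v * gvert F v) (gvert F v)
  | vertNe {v w : V} (h : v ≠ w) : LeavittRel (gvert F v * gvert F w) 0
  | edgeSource (e : E) : LeavittRel (gvert F (s e) * gedge F e) (gedge F e)
  | edgeRange (e : E) : LeavittRel (gedge F e * gvert F (r e)) (gedge F e)
  | starRange (e : E) : LeavittRel (gvert F (r e) * gstar F e) (gstar F e)
  | starSource (e : E) : LeavittRel (gstar F e * gvert F (s e)) (gstar F e)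
  | starEdgeSelf (e : E) : LeavittRel (gstar F e * gedge F e) (gvert F (r e))
  | starEdgeNe {e f : E} (h : e ≠ f) : LeavittRel (gstar F e * gedge F f) 0
  | ck (v : V) (h : {e : E | s e = v}.Finite) (hne : ∃ e, s e = v) :
      LeavittRel (gvert F v) (∑ e ∈ h.toFinset, gedge F e * gstar F e)

/-- The Leavitt path algebra `L(Γ)` of the graph `Γ = (V, E, s, r)` over the field `F`,
presented as the quotient of the free algebra on the generators by the Leavitt relations. -/
noncomputable abbrev LeavittPathAlgebra := RingQuot (LeavittRel F s r)

/-- The image of a vertex in the Leavitt path algebra. -/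
noncomputable def lvert (v : V) : LeavittPathAlgebra F s r :=
  RingQuot.mkAlgHom F (LeavittRel F s r) (gvert F v)

/-- The image of an edge in the Leavitt path algebra. -/
noncomputable def ledge (e : E) : LeavittPathAlgebra F s r :=
  RingQuot.mkAlgHom F (LeavittRel F s r) (gedge F e)

/-- The image of a ghost edge `e*` in the Leavitt path algebra. -/
noncomputable def lstar (e : E) : LeavittPathAlgebra F s r :=
  RingQuot.mkAlgHom F (LeavittRel F s r) (gstar F e)

/-- The element of the Leavitt path algebra given by a path `p = e₁ ⋯ eₙ` (a list of edges). -/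
noncomputable def lpath (p : List E) : LeavittPathAlgebra F s r := (p.map (ledge F s r)).prod

/-- The element `p* = eₙ* ⋯ e₁*` of the Leavitt path algebra given by a path `p = e₁ ⋯ eₙ`. -/
noncomputable def lpathStar (p : List E) : LeavittPathAlgebra F s r :=
  (p.reverse.map (lstar F s r)).prod

/-- A list of edges is a path when the range of each edge is the source of the next. -/
def IsPath (s r : E → V) (p : List E) : Prop := List.Chain' (fun e f => r e = s f) p

/-- A nonempty path starts at the source of its first edge. -/
def StartsAt (s : E → V) (p : List E) (v : V) : Prop := ∃ e, p.head? = some e ∧ s e = v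

/-- A nonempty path ends at the range of its last edge. -/
def EndsAt (r : E → V) (p : List E) (v : V) : Prop := ∃ e, p.getLast? = some e ∧ r e = v

/-- A (nonempty) closed path: it starts and ends at the same vertex. -/
def IsClosedPath (s r : E → V) (p : List E) : Prop := ∃ v, StartsAt s p v ∧ EndsAt r p v

/-- A cycle: a closed path whose source vertices are pairwise distinct.  A cycle is
identified with the subgraph it spans, i.e. with its set of edges `{e | e ∈ p}`. -/
def IsCycle (s r : E → V) (p : List E) : Prop :=
  IsPath s r p ∧ IsClosedPath s r p ∧ (p.map s).Nodup

/-- The vertex set `V(C)` of a cycle (the sources of its edges). -/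
def cycleVerts (s : E → V) (c : List E) : Set V := {v | ∃ e ∈ c, s e = v}

/-- `C ⟹ C'`: some (possibly empty) path starts at a vertex of `C` and ends at a
vertex of `C'`. -/
def CycleConnects (s r : E → V) (c c' : List E) : Prop :=
  ∃ v w, v ∈ cycleVerts s c ∧ w ∈ cycleVerts s c' ∧
    (v = w ∨ ∃ p, p ≠ [] ∧ IsPath s r p ∧ StartsAt s p v ∧ EndsAt r p w)

/-- A chain of cycles `C₁ ⟹ C₂ ⟹ ⋯ ⟹ C_k`: pairwise distinct cycles, each connected
to the next; its length is the number of cycles. -/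
def IsChainOfCycles (s r : E → V) (cs : List (List E)) : Prop :=
  (∀ c ∈ cs, IsCycle s r c) ∧ List.Chain' (CycleConnects s r) cs ∧
    List.Pairwise (fun c c' => {e | e ∈ c} ≠ {e | e ∈ c'}) cs

/-- A cycle has an exit if some edge starts at a vertex of the cycle but is not an
edge of the cycle. -/
def HasExit (s : E → V) (c : List E) : Prop := ∃ e, s e ∈ cycleVerts s c ∧ e ∉ c

/-- A chain of cycles with an exit: the last cycle of the chain has an exit. -/
def ChainWithExit (s r : E → V) (cs : List (List E)) : Prop :=
  IsChainOfCycles s r cs ∧ ∃ c, cs.getLast? = some c ∧ HasExit s c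

/-- Any two distinct cycles of the graph have no common vertex: two cycles sharing a
vertex coincide (have the same edge set). -/
def SeparatedCycles (s r : E → V) : Prop :=
  ∀ c c', IsCycle s r c → IsCycle s r c' →
    (cycleVerts s c ∩ cycleVerts s c').Nonempty → {e | e ∈ c} = {e | e ∈ c'}

/-- `W + W² + ⋯ + Wⁿ` for a subspace `W` of an `F`-algebra. -/
noncomputable def powsSum {A : Type} [Semiring A] [Algebra F A]
    (W : Submodule F A) (n : ℕ) : Submodule F A :=
  ∑ i ∈ Finset.Icc 1 n, W ^ i


/-! ### Combinatorics of paths -/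

/-- `Pth s r a p b`: the list `p` is a (possibly empty) path from `a` to `b`. -/
inductive Pth (s r : E → V) : V → List E → V → Prop
  | nil (a : V) : Pth s r a [] a
  | cons (e : E) {l : List E} {b : V} (h : Pth s r (r e) l b) : Pth s r (s e) (e :: l) b

theorem Pth.append {s r : E → V} {a b c : V} {p q : List E} (hp : Pth s r a p b)
    (hq : Pth s r b q c) : Pth s r a (p ++ q) c := by
  induction hp with
  | nil a => exact hq
  | cons e h ih => exact Pth.cons e (ih hq)

theorem Pth.split {s r : E → V} {a c : V} {p q : List E} (h : Pth s r a (p ++ q) c) :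
    ∃ b, Pth s r a p b ∧ Pth s r b q c := by
  induction p generalizing a with
  | nil => exact ⟨a, Pth.nil a, h⟩
  | cons e p ih =>
    cases h with
    | cons _ h =>
      obtain ⟨b, h1, h2⟩ := ih h
      exact ⟨b, Pth.cons e h1, h2⟩

theorem Pth.source_eq {s r : E → V} {a c : V} {e : E} {q : List E}
    (h : Pth s r a (e :: q) c) : s e = a := by
  cases h; rfl

theorem Pth.isPath {s r : E → V} {a c : V} {p : List E}
    (h : Pth s r a p c) : IsPath s r p := by
  unfold IsPath
  induction h with
  | nil a => exact List.IsChain.nil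
  | @cons e l b h ih =>
    cases l with
    | nil => exact List.IsChain.singleton _
    | cons f l => exact List.IsChain.cons_cons h.source_eq.symm ih

theorem IsPath.exists_pth {s r : E → V} {e : E} {p : List E}
    (h : IsPath s r (e :: p)) : ∃ c, Pth s r (s e) (e :: p) c := by
  unfold IsPath at h
  induction p generalizing e with
  | nil => exact ⟨r e, Pth.cons e (Pth.nil _)⟩
  | cons f p ih =>
    replace h := List.isChain_cons_cons.1 h
    obtain ⟨c, hc⟩ := ih h.2
    refine ⟨c, Pth.cons e ?_⟩
    rw [h.1]
    exact hc

theorem Pth.endsAt {s r : E → V} {a c : V} {p : List E}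
    (h : Pth s r a p c) (hp : p ≠ []) : EndsAt r p c := by
  induction h with
  | nil a => exact absurd rfl hp
  | @cons e l b h ih =>
    cases l with
    | nil =>
      generalize hx : r e = x at h
      cases h
      exact ⟨e, rfl, hx⟩
    | cons f l =>
      obtain ⟨g, h1, h2⟩ := ih (by simp)
      refine ⟨g, ?_, h2⟩
      rw [List.getLast?_cons_cons]
      exact h1

theorem endsAt_unique {r : E → V} {p : List E} {a b : V} (h : EndsAt r p a)
    (h' : EndsAt r p b) : a = b := by
  obtain ⟨e, h1, rfl⟩ := h
  obtain ⟨f, h2, rfl⟩ := h'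
  rw [h1] at h2
  cases h2
  rfl

theorem IsCycle.exists_pth {s r : E → V} {c : List E} (h : IsCycle s r c) :
    ∃ a, Pth s r a c a := by
  obtain ⟨h1, ⟨v, ⟨e, he, hv⟩, h3⟩, -⟩ := h
  cases c with
  | nil => simp at he
  | cons f l =>
    simp only [List.head?_cons, Option.some.injEq] at he
    subst he
    obtain ⟨w, hw⟩ := h1.exists_pth
    have := endsAt_unique h3 (hw.endsAt (by simp))
    subst this
    subst hv
    exact ⟨_, hw⟩

/-- A cycle can be rotated so that it starts at any given vertex of it. -/
theorem IsCycle.rotate {s r : E → V} {c : List E} (h : IsCycle s r c) {v : V}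
    (hv : v ∈ cycleVerts s c) :
    ∃ p, p ≠ [] ∧ Pth s r v p v ∧ (p.map s).Nodup ∧ ∀ e, e ∈ p ↔ e ∈ c := by
  obtain ⟨a, ha⟩ := h.exists_pth
  obtain ⟨e, he, rfl⟩ := hv
  obtain ⟨l1, l2, rfl⟩ := List.append_of_mem he
  obtain ⟨b, h1, h2⟩ := ha.split
  have hb := h2.source_eq
  subst hb
  refine ⟨(e :: l2) ++ l1, by simp, h2.append h1, ?_, ?_⟩
  · have := h.2.2
    rw [List.map_append] at this ⊢
    exact (List.perm_append_comm.nodup_iff).1 this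
  · intro f
    rw [List.mem_append, List.mem_append, or_comm]

/-- Loop erasure. -/
theorem Pth.erase {s r : E → V} {a b : V} {p : List E} (h : Pth s r a p b) :
    ∃ q, Pth s r a q b ∧ (q.map s).Nodup ∧ b ∉ q.map s := by
  classical
  induction h with
  | nil a => exact ⟨[], Pth.nil a, by simp, by simp⟩
  | @cons e l b h ih =>
    obtain ⟨q, h1, h2, h3⟩ := ih
    by_cases hb : s e = b
    · subst hb
      exact ⟨[], Pth.nil _, by simp, by simp⟩
    by_cases hm : s e ∈ q.map s
    · rw [List.mem_map] at hm
      obtain ⟨f, hf, hfe⟩ := hm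
      obtain ⟨l1, l2, rfl⟩ := List.append_of_mem hf
      obtain ⟨c, h4, h5⟩ := h1.split
      have hc := h5.source_eq
      subst hc
      refine ⟨f :: l2, hfe ▸ h5, ?_, ?_⟩
      · rw [List.map_append] at h2
        exact (List.nodup_append.1 h2).2.1
      · intro hh
        apply h3
        rw [List.map_append]
        exact List.mem_append_right _ hh
    · refine ⟨e :: q, Pth.cons e h1, ?_, ?_⟩
      · rw [List.map_cons, List.nodup_cons]
        exact ⟨hm, h2⟩
      · rw [List.map_cons, List.mem_cons]
        rintro (h | h)
        · exact hb h.symm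
        · exact h3 h

/-- A closed path through `e` gives a cycle through `e`. -/
theorem exists_cycle_of_pth {s r : E → V} {e : E} {p : List E}
    (h : Pth s r (r e) p (s e)) : ∃ c, IsCycle s r c ∧ e ∈ c := by
  obtain ⟨q, h1, h2, h3⟩ := h.erase
  have h4 := Pth.cons e h1
  refine ⟨e :: q, ⟨h4.isPath, ⟨s e, ⟨e, rfl, rfl⟩, h4.endsAt (by simp)⟩, ?_⟩, by simp⟩
  rw [List.map_cons, List.nodup_cons]
  exact ⟨h3, h2⟩

theorem SeparatedCycles.edge_unique {s r : E → V} (hs : SeparatedCycles s r) {e f : E}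
    {p q : List E} (hp : Pth s r (r e) p (s e)) (hq : Pth s r (r f) q (s f))
    (hef : s e = s f) : e = f := by
  obtain ⟨c, hc, hec⟩ := exists_cycle_of_pth hp
  obtain ⟨c', hc', hfc⟩ := exists_cycle_of_pth hq
  have h := hs c c' hc hc' ⟨s e, ⟨e, hec, rfl⟩, ⟨f, hfc, hef.symm⟩⟩
  have hf : f ∈ c := by
    have : f ∈ {e | e ∈ c'} := hfc
    rwa [← h] at this
  exact List.inj_on_of_nodup_map hc.2.2 hec hf hef

/-- If an edge occurs twice in a path, it lies on a closed path. -/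
theorem IsPath.closed_of_repeat {s r : E → V} {p : List E} (h : IsPath s r p) {i j : ℕ}
    (hij : i < j) (hj : j < p.length) (he : p[i] = p[j]) :
    ∃ q, Pth s r (r p[j]) q (s p[j]) := by
  have h1 : p = p.take i ++ (p[i] :: ((p.drop (i+1)).take (j - (i+1)) ++ p[j] :: p.drop (j+1))) := by
    have e1 : p[j] :: p.drop (j+1) = (p.drop (i+1)).drop (j - (i+1)) := by
      rw [List.drop_drop, show i + 1 + (j - (i+1)) = j by omega]
      exact (List.drop_eq_getElem_cons hj).symm
    rw [e1, List.take_append_drop, ← List.drop_eq_getElem_cons, List.take_append_drop]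
  have h2 : IsPath s r (p[i] :: ((p.drop (i+1)).take (j - (i+1)) ++ p[j] :: p.drop (j+1))) := by
    unfold IsPath at h ⊢
    rw [h1] at h
    exact h.right_of_append
  obtain ⟨c, hc⟩ := h2.exists_pth
  generalize hg : s p[i] = a at hc
  cases hc with
  | cons _ hc =>
    obtain ⟨b, h3, h4⟩ := hc.split
    have := h4.source_eq
    subst this
    rw [he] at h3
    exact ⟨_, h3⟩

/-- In a graph with separated cycles, a path is determined by its length and by the first
occurrence of each edge. -/
theorem SeparatedCycles.path_ext [DecidableEq E] {s r : E → V} (hs : SeparatedCycles s r)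
    {p q : List E} (hp : IsPath s r p) (hq : IsPath s r q) (hl : p.length = q.length)
    (h : ∀ e, p.idxOf e = q.idxOf e) : p = q := by
  have key : ∀ i (h1 : i < p.length) (h2 : i < q.length), p[i] = q[i] := by
    intro i
    induction i with
    | zero =>
      intro h1 h2
      have h3 : p.idxOf p[0] = 0 := by
        cases p with
        | nil => simp at h1
        | cons a l => simp
      have h4 := h p[0]
      rw [h3] at h4
      have h5 : q[q.idxOf p[0]]'(by omega) = p[0] := List.getElem_idxOf _
      simp only [← h4] at h5
      exact h5.symm
    | succ i ih =>
      intro h1 h2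
      by_contra hne
      have hsrc : s p[i+1] = s q[i+1] := by
        have e1 := List.isChain_iff_getElem.1 hp i h1
        have e2 := List.isChain_iff_getElem.1 hq i h2
        rw [← e1, ← e2, ih (by omega) (by omega)]
      have aux : ∀ (p q : List E) (hp : IsPath s r p) (h : ∀ e, p.idxOf e = q.idxOf e)
          (h1 : i + 1 < p.length) (h2 : i + 1 < q.length) (hne : p[i+1] ≠ q[i+1]),
          ∃ l, Pth s r (r p[i+1]) l (s p[i+1]) := by
        intro p q hp h h1 h2 hne
        have hlt : p.idxOf p[i+1] < p.length := List.idxOf_lt_length_iff.2 (List.getElem_mem _)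
        have hle : p.idxOf p[i+1] ≤ i + 1 := by
          by_contra hcon
          have := List.not_of_lt_findIdx (p := (· == p[i+1])) (xs := p) (i := i+1)
            (by rw [List.idxOf] at hcon; omega)
          simp at this
        rcases Nat.lt_or_eq_of_le hle with hlt' | heq
        · exact hp.closed_of_repeat hlt' h1 (List.getElem_idxOf _)
        · exfalso
          have h4 := h p[i+1]
          rw [heq] at h4
          have h5 : q[q.idxOf p[i+1]]'(by omega) = p[i+1] := List.getElem_idxOf _
          simp only [← h4] at h5
          exact hne h5.symm
      obtain ⟨l1, hl1⟩ := aux p q hp h h1 h2 hne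
      obtain ⟨l2, hl2⟩ := aux q p hq (fun e => (h e).symm) h2 h1 (fun h => hne h.symm)
      exact hne (hs.edge_unique hl1 hl2 hsrc)
  exact List.ext_getElem hl key

/-- Paths of length at most `n`. -/
def pathsLE (s r : E → V) (n : ℕ) : Set (List E) := {p | IsPath s r p ∧ p.length ≤ n}

theorem SeparatedCycles.pathsLE_card [Fintype E] {s r : E → V} (hs : SeparatedCycles s r) (n : ℕ) :
    ∃ T : Finset (List E), (∀ p, p ∈ T ↔ IsPath s r p ∧ p.length ≤ n) ∧
      T.card ≤ (n + 1) ^ (Fintype.card E + 1) := by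
  classical
  let g : pathsLE s r n → Fin (n+1) × (E → Fin (n+1)) := fun p =>
    (⟨p.1.length, by have := p.2.2; omega⟩,
      fun e => ⟨p.1.idxOf e, by
        have := p.2.2
        have := List.idxOf_le_length (a := e) (l := p.1)
        omega⟩)
  have hg : Function.Injective g := by
    intro p q hpq
    apply Subtype.ext
    have h1 := congrArg Prod.fst hpq
    have h2 := congrArg Prod.snd hpq
    refine hs.path_ext p.2.1 q.2.1 (by simpa [g] using h1) ?_
    intro e
    have := congrFun h2 e
    simpa [g] using this
  have : Finite (pathsLE s r n) := Finite.of_injective g hg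
  have : Fintype (pathsLE s r n) := Fintype.ofFinite _
  refine ⟨(pathsLE s r n).toFinset, ?_, ?_⟩
  · intro p
    rw [Set.mem_toFinset]
    rfl
  · rw [Set.toFinset_card]
    refine (Fintype.card_le_of_injective g hg).trans ?_
    rw [Fintype.card_prod, Fintype.card_fun, Fintype.card_fin, pow_succ]
    exact (mul_comm _ _).le

/-! ### Relations in the Leavitt path algebra -/

theorem lvert_mul_self (v : V) : lvert F s r v * lvert F s r v = lvert F s r v := by
  unfold lvert
  rw [← map_mul]
  exact RingQuot.mkAlgHom_rel F (LeavittRel.vertSelf v)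

theorem lvert_mul_ne {v w : V} (h : v ≠ w) : lvert F s r v * lvert F s r w = 0 := by
  unfold lvert
  rw [← map_mul, ← map_zero (RingQuot.mkAlgHom F (LeavittRel F s r))]
  exact RingQuot.mkAlgHom_rel F (LeavittRel.vertNe h)

theorem lvert_mul_ledge (e : E) : lvert F s r (s e) * ledge F s r e = ledge F s r e := by
  unfold lvert ledge
  rw [← map_mul]
  exact RingQuot.mkAlgHom_rel F (LeavittRel.edgeSource e)

theorem ledge_mul_lvert (e : E) : ledge F s r e * lvert F s r (r e) = ledge F s r e := by
  unfold lvert ledge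
  rw [← map_mul]
  exact RingQuot.mkAlgHom_rel F (LeavittRel.edgeRange e)

theorem lvert_mul_lstar (e : E) : lvert F s r (r e) * lstar F s r e = lstar F s r e := by
  unfold lvert lstar
  rw [← map_mul]
  exact RingQuot.mkAlgHom_rel F (LeavittRel.starRange e)

theorem lstar_mul_lvert (e : E) : lstar F s r e * lvert F s r (s e) = lstar F s r e := by
  unfold lvert lstar
  rw [← map_mul]
  exact RingQuot.mkAlgHom_rel F (LeavittRel.starSource e)

theorem lstar_mul_ledge (e : E) : lstar F s r e * ledge F s r e = lvert F s r (r e) := by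
  unfold lvert lstar ledge
  rw [← map_mul]
  exact RingQuot.mkAlgHom_rel F (LeavittRel.starEdgeSelf e)

theorem lstar_mul_ledge_ne {e f : E} (h : e ≠ f) : lstar F s r e * ledge F s r f = 0 := by
  unfold lstar ledge
  rw [← map_mul, ← map_zero (RingQuot.mkAlgHom F (LeavittRel F s r))]
  exact RingQuot.mkAlgHom_rel F (LeavittRel.starEdgeNe h)

theorem lvert_mul_ledge_ne {v : V} {e : E} (h : v ≠ s e) :
    lvert F s r v * ledge F s r e = 0 := by
  rw [← lvert_mul_ledge, ← mul_assoc, lvert_mul_ne F s r h, zero_mul]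

theorem lstar_mul_lvert_ne {v : V} {e : E} (h : s e ≠ v) :
    lstar F s r e * lvert F s r v = 0 := by
  rw [← lstar_mul_lvert, mul_assoc, lvert_mul_ne F s r h, mul_zero]

theorem ledge_mul_ledge_ne {e f : E} (h : r e ≠ s f) :
    ledge F s r e * ledge F s r f = 0 := by
  rw [← ledge_mul_lvert, mul_assoc, lvert_mul_ledge_ne F s r h, mul_zero]

theorem lstar_mul_lstar_ne {e f : E} (h : s e ≠ r f) :
    lstar F s r e * lstar F s r f = 0 := by
  rw [← lvert_mul_lstar F s r f, ← mul_assoc, lstar_mul_lvert_ne F s r h, zero_mul]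

theorem lpath_nil : lpath F s r [] = 1 := by simp [lpath]

theorem lpath_cons (e : E) (p : List E) :
    lpath F s r (e :: p) = ledge F s r e * lpath F s r p := by simp [lpath]

theorem lpathStar_nil : lpathStar F s r [] = 1 := by simp [lpathStar]

theorem lpathStar_cons (e : E) (p : List E) :
    lpathStar F s r (e :: p) = lpathStar F s r p * lstar F s r e := by simp [lpathStar]

theorem lpathStar_concat (e : E) (p : List E) :
    lpathStar F s r (p ++ [e]) = lstar F s r e * lpathStar F s r p := by simp [lpathStar]

/-! ### Upper bound -/

/-- The monomial `p v q*`. -/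
noncomputable def lmon (x : List E × V × List E) : LeavittPathAlgebra F s r :=
  lpath F s r x.1 * lvert F s r x.2.1 * lpathStar F s r x.2.2

/-- The generators together with `1`. -/
def lgens : Set (LeavittPathAlgebra F s r) :=
  {x | x = 1 ∨ (∃ v, x = lvert F s r v) ∨ (∃ e, x = ledge F s r e) ∨ (∃ e, x = lstar F s r e)}

/-- Span of `1` and the monomials built from paths of length at most `n`. -/
noncomputable def monSpan (n : ℕ) : Submodule F (LeavittPathAlgebra F s r) :=
  Submodule.span F {x | x = 1 ∨ ∃ p v q, IsPath s r p ∧ IsPath s r q ∧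
    p.length ≤ n ∧ q.length ≤ n ∧ x = lmon F s r (p, v, q)}

theorem mon_mem_monSpan {n : ℕ} {p q : List E} (v : V) (hp : IsPath s r p) (hq : IsPath s r q)
    (hpn : p.length ≤ n) (hqn : q.length ≤ n) : lmon F s r (p, v, q) ∈ monSpan F s r n :=
  Submodule.subset_span (Or.inr ⟨p, v, q, hp, hq, hpn, hqn, rfl⟩)

theorem monSpan_mono {m n : ℕ} (h : m ≤ n) : monSpan F s r m ≤ monSpan F s r n := by
  apply Submodule.span_mono
  rintro x (rfl | ⟨p, v, q, hp, hq, h1, h2, rfl⟩)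
  · exact Or.inl rfl
  · exact Or.inr ⟨p, v, q, hp, hq, h1.trans h, h2.trans h, rfl⟩

theorem isPath_nil : IsPath s r [] := List.IsChain.nil

theorem isPath_singleton (e : E) : IsPath s r [e] := List.IsChain.singleton e

theorem isPath_tail {e : E} {p : List E} (h : IsPath s r (e :: p)) : IsPath s r p :=
  List.IsChain.of_cons h

theorem vert_mul_mon {n : ℕ} {p q : List E} (w v : V) (hp : IsPath s r p) (hq : IsPath s r q)
    (hpn : p.length ≤ n) (hqn : q.length ≤ n) :
    lvert F s r w * lmon F s r (p, v, q) ∈ monSpan F s r n := by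
  classical
  have hmem := mon_mem_monSpan F s r v hp hq hpn hqn
  cases p with
  | nil =>
    by_cases h : w = v
    · subst h
      have : lvert F s r w * lmon F s r ([], w, q) = lmon F s r ([], w, q) := by
        simp only [lmon, lpath_nil, one_mul]
        rw [← mul_assoc, lvert_mul_self]
      rwa [this]
    · have : lvert F s r w * lmon F s r ([], v, q) = 0 := by
        simp only [lmon, lpath_nil, one_mul]
        rw [← mul_assoc, lvert_mul_ne F s r h, zero_mul]
      rw [this]
      exact zero_mem _
  | cons f p =>
    by_cases h : w = s f
    · subst h
      have : lvert F s r (s f) * lmon F s r (f :: p, v, q) = lmon F s r (f :: p, v, q) := by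
        simp only [lmon, lpath_cons, mul_assoc]
        rw [← mul_assoc, lvert_mul_ledge]
      rwa [this]
    · have : lvert F s r w * lmon F s r (f :: p, v, q) = 0 := by
        simp only [lmon, lpath_cons, mul_assoc]
        rw [← mul_assoc, lvert_mul_ledge_ne F s r h, zero_mul]
      rw [this]
      exact zero_mem _

theorem edge_mul_mon {n : ℕ} {p q : List E} (e : E) (v : V) (hp : IsPath s r p)
    (hq : IsPath s r q) (hpn : p.length ≤ n) (hqn : q.length ≤ n) :
    ledge F s r e * lmon F s r (p, v, q) ∈ monSpan F s r (n + 1) := by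
  classical
  by_cases hep : IsPath s r (e :: p)
  · have : ledge F s r e * lmon F s r (p, v, q) = lmon F s r (e :: p, v, q) := by
      simp only [lmon, lpath_cons, mul_assoc]
    rw [this]
    exact mon_mem_monSpan F s r v hep hq (by simpa using hpn) (by omega)
  · cases p with
    | nil => exact absurd (isPath_singleton s r e) hep
    | cons f p =>
      have h : r e ≠ s f := fun h => hep (List.IsChain.cons_cons h hp)
      have : ledge F s r e * lmon F s r (f :: p, v, q) = 0 := by
        simp only [lmon, lpath_cons, mul_assoc]
        rw [← mul_assoc, ledge_mul_ledge_ne F s r h, zero_mul]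
      rw [this]
      exact zero_mem _

theorem star_mul_mon {n : ℕ} {p q : List E} (e : E) (v : V) (hp : IsPath s r p)
    (hq : IsPath s r q) (hpn : p.length ≤ n) (hqn : q.length ≤ n) :
    lstar F s r e * lmon F s r (p, v, q) ∈ monSpan F s r (n + 1) := by
  classical
  cases p with
  | nil =>
    by_cases h : s e = v
    · subst h
      have h1 : lstar F s r e * lmon F s r ([], s e, q) = lmon F s r ([], r e, q ++ [e]) := by
        simp only [lmon, lpath_nil, one_mul, lpathStar_concat]
        rw [← mul_assoc, ← mul_assoc, lstar_mul_lvert, lvert_mul_lstar]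
      by_cases hqe : IsPath s r (q ++ [e])
      · rw [h1]
        exact mon_mem_monSpan F s r _ (isPath_nil s r) hqe (by simp) (by simpa using hqn)
      · rcases List.eq_nil_or_concat q with rfl | ⟨q', g, rfl⟩
        · exact absurd (isPath_singleton s r e) hqe
        · have h : s e ≠ r g := by
            intro h
            apply hqe
            unfold IsPath
            refine List.isChain_append.2 ⟨hq, List.IsChain.singleton e, ?_⟩
            intro x hx y hy
            simp at hx hy
            subst hx
            subst hy
            exact h.symm
          rw [h1]
          simp only [lmon, lpath_nil, one_mul, lpathStar_concat, List.concat_eq_append]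
          rw [← mul_assoc (lstar F s r e), lstar_mul_lstar_ne F s r h, zero_mul, mul_zero]
          exact zero_mem _
    · have : lstar F s r e * lmon F s r ([], v, q) = 0 := by
        simp only [lmon, lpath_nil, one_mul]
        rw [← mul_assoc, lstar_mul_lvert_ne F s r h, zero_mul]
      rw [this]
      exact zero_mem _
  | cons f p =>
    by_cases h : e = f
    · subst h
      have h1 : lstar F s r e * lmon F s r (e :: p, v, q) =
          lvert F s r (r e) * lmon F s r (p, v, q) := by
        simp only [lmon, lpath_cons, mul_assoc]
        rw [← mul_assoc, lstar_mul_ledge]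
      rw [h1]
      simp only [List.length_cons] at hpn
      exact monSpan_mono F s r (Nat.le_succ n)
        (vert_mul_mon F s r (r e) v (isPath_tail s r hp) hq (by omega) hqn)
    · have : lstar F s r e * lmon F s r (f :: p, v, q) = 0 := by
        simp only [lmon, lpath_cons, mul_assoc]
        rw [← mul_assoc, lstar_mul_ledge_ne F s r h, zero_mul]
      rw [this]
      exact zero_mem _

theorem gens_mul_monSpan (n : ℕ) :
    Submodule.span F (lgens F s r) * monSpan F s r n ≤ monSpan F s r (n + 1) := by
  unfold monSpan
  rw [Submodule.span_mul_span, Submodule.span_le]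
  rintro _ ⟨x, hx, y, hy, rfl⟩
  change x * y ∈ monSpan F s r (n + 1)
  have h0 := isPath_nil s r
  rcases hx with rfl | ⟨w, rfl⟩ | ⟨e, rfl⟩ | ⟨e, rfl⟩ <;>
    rcases hy with rfl | ⟨p, v, q, hp, hq, hpn, hqn, rfl⟩
  · rw [one_mul]
    exact Submodule.subset_span (Or.inl rfl)
  · rw [one_mul]
    exact mon_mem_monSpan F s r v hp hq (by omega) (by omega)
  · have := mon_mem_monSpan F s r (n := n + 1) w h0 h0 (by simp) (by simp)
    simpa [lmon, lpath_nil, lpathStar_nil] using this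
  · exact monSpan_mono F s r (Nat.le_succ n) (vert_mul_mon F s r w v hp hq hpn hqn)
  · have := mon_mem_monSpan F s r (n := n + 1) (r e) (isPath_singleton s r e) h0
      (by simp) (by simp)
    simpa [lmon, lpath_nil, lpath_cons, lpathStar_nil, ledge_mul_lvert] using this
  · exact edge_mul_mon F s r e v hp hq hpn hqn
  · have := mon_mem_monSpan F s r (n := n + 1) (r e) h0 (isPath_singleton s r e)
      (by simp) (by simp)
    simpa [lmon, lpath_nil, lpathStar_cons, lpathStar_nil, lvert_mul_lstar] using this
  · exact star_mul_mon F s r e v hp hq hpn hqn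

theorem gens_pow_le (n : ℕ) : Submodule.span F (lgens F s r) ^ n ≤ monSpan F s r n := by
  induction n with
  | zero =>
    rw [pow_zero, Submodule.one_eq_span, Submodule.span_le, Set.singleton_subset_iff]
    exact Submodule.subset_span (Or.inl rfl)
  | succ n ih =>
    rw [pow_succ']
    exact (mul_le_mul' le_rfl ih).trans (gens_mul_monSpan F s r n)

theorem one_le_gens : (1 : Submodule F (LeavittPathAlgebra F s r)) ≤
    Submodule.span F (lgens F s r) := by
  rw [Submodule.one_eq_span, Submodule.span_le, Set.singleton_subset_iff]
  exact Submodule.subset_span (Or.inl rfl)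

theorem exists_mem_gens_pow (x : LeavittPathAlgebra F s r) :
    ∃ n, x ∈ Submodule.span F (lgens F s r) ^ n := by
  obtain ⟨y, rfl⟩ := RingQuot.mkAlgHom_surjective F (LeavittRel F s r) x
  induction y using FreeAlgebra.induction with
  | grade0 c =>
    refine ⟨0, ?_⟩
    rw [pow_zero, AlgHom.commutes]
    exact Submodule.algebraMap_mem c
  | grade1 g =>
    refine ⟨1, ?_⟩
    rw [pow_one]
    apply Submodule.subset_span
    cases g with
    | vert v => exact Or.inr (Or.inl ⟨v, rfl⟩)
    | edge e => exact Or.inr (Or.inr (Or.inl ⟨e, rfl⟩))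
    | star e => exact Or.inr (Or.inr (Or.inr ⟨e, rfl⟩))
  | mul a b ha hb =>
    obtain ⟨m, hm⟩ := ha
    obtain ⟨n, hn⟩ := hb
    refine ⟨m + n, ?_⟩
    rw [map_mul, pow_add]
    exact Submodule.mul_mem_mul hm hn
  | add a b ha hb =>
    obtain ⟨m, hm⟩ := ha
    obtain ⟨n, hn⟩ := hb
    refine ⟨m + n, ?_⟩
    rw [map_add]
    exact add_mem (pow_le_pow_right₀ (one_le_gens F s r) (Nat.le_add_right m n) hm)
      (pow_le_pow_right₀ (one_le_gens F s r) (Nat.le_add_left n m) hn)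

theorem exists_le_gens_pow (W : Submodule F (LeavittPathAlgebra F s r)) (hW : W.FG) :
    ∃ m, W ≤ Submodule.span F (lgens F s r) ^ m := by
  obtain ⟨t, rfl⟩ := hW
  choose g hg using exists_mem_gens_pow F s r
  refine ⟨t.sup g, ?_⟩
  rw [Submodule.span_le]
  intro x hx
  exact pow_le_pow_right₀ (one_le_gens F s r) (Finset.le_sup hx) (hg x)

theorem powsSum_le {A : Type} [Semiring A] [Algebra F A] {W K : Submodule F A} {n : ℕ}
    (h : ∀ i, 1 ≤ i → i ≤ n → W ^ i ≤ K) : powsSum F W n ≤ K := by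
  unfold powsSum
  apply Finset.sum_induction _ (· ≤ K)
  · intro a b ha hb
    rw [Submodule.add_eq_sup]
    exact sup_le ha hb
  · exact bot_le
  · intro i hi
    rw [Finset.mem_Icc] at hi
    exact h i hi.1 hi.2

theorem pow_le_powsSum {A : Type} [Semiring A] [Algebra F A] {W : Submodule F A} {i n : ℕ}
    (h1 : 1 ≤ i) (h2 : i ≤ n) : W ^ i ≤ powsSum F W n := by
  unfold powsSum
  exact Finset.single_le_sum_of_canonicallyOrdered (f := fun i => W ^ i)
    (Finset.mem_Icc.2 ⟨h1, h2⟩)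

theorem powsSum_mono {A : Type} [Semiring A] [Algebra F A] {W : Submodule F A} {m n : ℕ}
    (h : m ≤ n) : powsSum F W m ≤ powsSum F W n :=
  powsSum_le F fun _ h1 h2 => pow_le_powsSum F h1 (h2.trans h)

theorem powsSum_mul {A : Type} [Semiring A] [Algebra F A] (W : Submodule F A) (m n : ℕ) :
    powsSum F W m * powsSum F W n ≤ powsSum F W (m + n) := by
  rw [Submodule.mul_le]
  intro x hx y hy
  have h1 : powsSum F W m * powsSum F W n ≤ powsSum F W (m + n) := by
    conv_lhs => unfold powsSum
    rw [Finset.sum_mul_sum]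
    apply Finset.sum_induction _ (· ≤ powsSum F W (m + n))
    · intro a b ha hb
      rw [Submodule.add_eq_sup]
      exact sup_le ha hb
    · exact bot_le
    · intro i hi
      apply Finset.sum_induction _ (· ≤ powsSum F W (m + n))
      · intro a b ha hb
        rw [Submodule.add_eq_sup]
        exact sup_le ha hb
      · exact bot_le
      · intro j hj
        rw [Finset.mem_Icc] at hi hj
        rw [← pow_add]
        exact pow_le_powsSum F (by omega) (by omega)
  exact h1 (Submodule.mul_mem_mul hx hy)

theorem powsSum_fg {A : Type} [Semiring A] [Algebra F A] {W : Submodule F A} (hW : W.FG)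
    (n : ℕ) : (powsSum F W n).FG := by
  unfold powsSum
  apply Finset.sum_induction _ Submodule.FG
  · intro a b ha hb
    rw [Submodule.add_eq_sup]
    exact ha.sup hb
  · exact Submodule.fg_bot
  · intro i _
    exact hW.pow i

theorem monSpan_finrank [Fintype V] [Fintype E] (hs : SeparatedCycles s r) (n : ℕ) :
    (monSpan F s r n).FG ∧ Module.finrank F (monSpan F s r n) ≤
      1 + (n + 1) ^ (Fintype.card E + 1) * (Fintype.card V * (n + 1) ^ (Fintype.card E + 1)) := by
  classical
  obtain ⟨T, hT, hc⟩ := hs.pathsLE_card n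
  let Z : Finset (LeavittPathAlgebra F s r) :=
    insert 1 ((T ×ˢ (Finset.univ ×ˢ T)).image (lmon F s r))
  have hZ : monSpan F s r n = Submodule.span F (Z : Set (LeavittPathAlgebra F s r)) := by
    unfold monSpan
    congr 1
    ext x
    simp only [Z, Finset.coe_insert, Finset.coe_image, Set.mem_insert_iff, Set.mem_ofPred_eq,
      Set.mem_image, Finset.mem_coe, Finset.mem_product, Finset.mem_univ, true_and, hT,
      Prod.exists]
    constructor
    · rintro (h | ⟨p, v, q, h1, h2, h3, h4, rfl⟩)
      · exact Or.inl h
      · exact Or.inr ⟨p, v, q, ⟨⟨h1, h3⟩, h2, h4⟩, rfl⟩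
    · rintro (h | ⟨p, v, q, ⟨⟨h1, h3⟩, h2, h4⟩, rfl⟩)
      · exact Or.inl h
      · exact Or.inr ⟨p, v, q, h1, h2, h3, h4, rfl⟩
  have hcard : Z.card ≤ 1 + (n + 1) ^ (Fintype.card E + 1) *
      (Fintype.card V * (n + 1) ^ (Fintype.card E + 1)) := by
    refine (Finset.card_insert_le _ _).trans ?_
    rw [add_comm]
    refine Nat.add_le_add_left ?_ 1
    refine Finset.card_image_le.trans ?_
    rw [Finset.card_product, Finset.card_product, Finset.card_univ]
    gcongr
  rw [hZ]
  exact ⟨⟨Z, rfl⟩, (finrank_span_finset_le_card Z).trans hcard⟩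

theorem growth_upper [Fintype V] [Fintype E] (hs : SeparatedCycles s r)
    (W : Submodule F (LeavittPathAlgebra F s r)) (hW : W.FG) :
    ∃ (C : ℝ) (d : ℕ), ∀ n : ℕ, 1 ≤ n →
        (Module.finrank F (powsSum F W n) : ℝ) ≤ C * (n : ℝ) ^ d := by
  obtain ⟨m, hm⟩ := exists_le_gens_pow F s r W hW
  set k := Fintype.card E + 1 with hk
  set c := Fintype.card V with hcv
  refine ⟨((1 + (m + 1) ^ k * (c * (m + 1) ^ k) : ℕ) : ℝ), k + k, ?_⟩
  intro n hn
  have h1 : powsSum F W n ≤ monSpan F s r (m * n) := by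
    apply powsSum_le
    intro i _ hin
    refine le_trans ?_ (gens_pow_le F s r (m * n))
    refine (pow_le_pow_left' hm i).trans ?_
    rw [← pow_mul]
    exact pow_le_pow_right₀ (one_le_gens F s r) (Nat.mul_le_mul_left m hin)
  obtain ⟨hfg, hrk⟩ := monSpan_finrank F s r hs (m * n)
  have : Module.Finite F (monSpan F s r (m * n)) := Module.Finite.iff_fg.2 hfg
  have h2 := (Submodule.finrank_mono h1).trans hrk
  rw [← hk, ← hcv] at h2
  have h3 : (m * n + 1) ^ k ≤ (m + 1) ^ k * n ^ k := by
    rw [← mul_pow]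
    gcongr
    nlinarith
  have h4 : 1 ≤ n ^ (k + k) := Nat.one_le_pow _ _ hn
  have h5 : Module.finrank F (powsSum F W n) ≤
      (1 + (m + 1) ^ k * (c * (m + 1) ^ k)) * n ^ (k + k) := by
    refine h2.trans ?_
    calc 1 + (m * n + 1) ^ k * (c * (m * n + 1) ^ k)
        ≤ n ^ (k + k) + ((m + 1) ^ k * n ^ k) * (c * ((m + 1) ^ k * n ^ k)) := by gcongr
      _ = _ := by ring
  exact_mod_cast h5

/-! ### Vertices are nonzero -/

theorem exists_branching [Finite E] (s : E → V) : ∃ φ : E → ℕ → ℕ,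
    (∀ e f n m, s e = s f → φ e n = φ f m → e = f ∧ n = m) ∧
    (∀ v, (∃ e, s e = v) → ∀ m, ∃ e n, s e = v ∧ φ e n = m) := by
  classical
  have hψ : ∀ v, ∃ ψ : {e // s e = v} × ℕ → ℕ,
      Function.Injective ψ ∧ ((∃ e, s e = v) → Function.Surjective ψ) := by
    intro v
    by_cases h : ∃ e, s e = v
    · have : Nonempty {e // s e = v} := ⟨⟨h.choose, h.choose_spec⟩⟩
      obtain ⟨ψ⟩ := nonempty_equiv_of_countable (α := {e // s e = v} × ℕ) (β := ℕ)
      exact ⟨ψ, ψ.injective, fun _ => ψ.surjective⟩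
    · refine ⟨fun _ => 0, ?_, fun h' => absurd h' h⟩
      rintro ⟨⟨e, he⟩, -⟩
      exact absurd ⟨e, he⟩ h
  choose ψ h1 h2 using hψ
  refine ⟨fun e n => ψ (s e) (⟨e, rfl⟩, n), ?_, ?_⟩
  · intro e f n m hef h
    have key : ∀ v (hv : s f = v) (k : ℕ), ψ (s f) (⟨f, rfl⟩, k) = ψ v (⟨f, hv⟩, k) := by
      intro v hv k
      subst hv
      rfl
    simp only at h
    rw [key (s e) hef.symm m] at h
    have := h1 _ h
    simpa using this
  · intro v hv m
    obtain ⟨⟨⟨e, he⟩, n⟩, h⟩ := h2 v hv m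
    subst he
    exact ⟨e, n, rfl, h⟩

open Classical in
/-- Action of a vertex. -/
noncomputable def actVert (v : V) : Module.End F (V × ℕ → F) where
  toFun f x := if x.1 = v then f x else 0
  map_add' f g := by
    ext x
    by_cases h : x.1 = v <;> simp [h]
  map_smul' c f := by
    ext x
    by_cases h : x.1 = v <;> simp [h]

open Classical in
/-- Action of an edge. -/
noncomputable def actEdge (φ : E → ℕ → ℕ) (e : E) : Module.End F (V × ℕ → F) where
  toFun f x := if h : x.1 = s e ∧ ∃ n, φ e n = x.2 then f (r e, h.2.choose) else 0
  map_add' f g := by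
    ext x
    by_cases h : x.1 = s e ∧ ∃ n, φ e n = x.2 <;> simp [h]
  map_smul' c f := by
    ext x
    by_cases h : x.1 = s e ∧ ∃ n, φ e n = x.2 <;> simp [h]

open Classical in
/-- Action of a ghost edge. -/
noncomputable def actStar (φ : E → ℕ → ℕ) (e : E) : Module.End F (V × ℕ → F) where
  toFun f x := if x.1 = r e then f (s e, φ e x.2) else 0
  map_add' f g := by
    ext x
    by_cases h : x.1 = r e <;> simp [h]
  map_smul' c f := by
    ext x
    by_cases h : x.1 = r e <;> simp [h]

open Classical in
theorem actVert_apply (v : V) (f : V × ℕ → F) (x : V × ℕ) :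
    actVert F v f x = if x.1 = v then f x else 0 := rfl

open Classical in
theorem actStar_apply (φ : E → ℕ → ℕ) (e : E) (f : V × ℕ → F) (x : V × ℕ) :
    actStar F s r φ e f x = if x.1 = r e then f (s e, φ e x.2) else 0 := rfl

theorem actEdge_apply {φ : E → ℕ → ℕ}
    (hφ : ∀ e f n m, s e = s f → φ e n = φ f m → e = f ∧ n = m) (e : E) (f : V × ℕ → F) (n : ℕ) :
    actEdge F s r φ e f (s e, φ e n) = f (r e, n) := by
  have h : (s e, φ e n).1 = s e ∧ ∃ k, φ e k = (s e, φ e n).2 := ⟨rfl, n, rfl⟩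
  have h1 : actEdge F s r φ e f (s e, φ e n) = f (r e, h.2.choose) := dif_pos h
  have h2 := (hφ e e _ n rfl h.2.choose_spec).2
  rw [h1, h2]

theorem actEdge_apply_zero {φ : E → ℕ → ℕ} (e : E) (f : V × ℕ → F) (x : V × ℕ)
    (h : ∀ n, x ≠ (s e, φ e n)) : actEdge F s r φ e f x = 0 := by
  apply dif_neg
  rintro ⟨h1, n, h2⟩
  exact h n (Prod.ext h1 h2.symm)

/-- The generators act. -/
noncomputable def actGen (φ : E → ℕ → ℕ) : LGen V E → Module.End F (V × ℕ → F)
  | LGen.vert v => actVert F v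
  | LGen.edge e => actEdge F s r φ e
  | LGen.star e => actStar F s r φ e

theorem actGen_rel [Finite E] {φ : E → ℕ → ℕ}
    (hφ : ∀ e f n m, s e = s f → φ e n = φ f m → e = f ∧ n = m)
    (hφ' : ∀ v, (∃ e, s e = v) → ∀ m, ∃ e n, s e = v ∧ φ e n = m)
    ⦃x y : FreeAlgebra F (LGen V E)⦄ (h : LeavittRel F s r x y) :
    FreeAlgebra.lift F (actGen F s r φ) x = FreeAlgebra.lift F (actGen F s r φ) y := by
  classical
  have key : ∀ (e : E) (x : V × ℕ), (∃ n, x = (s e, φ e n)) ∨ (∀ n, x ≠ (s e, φ e n)) := by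
    intro e x
    by_cases h : ∃ n, x = (s e, φ e n)
    · exact Or.inl h
    · exact Or.inr (not_exists.1 h)
  induction h with
  | vertSelf v =>
    simp only [gvert, map_mul, FreeAlgebra.lift_ι_apply, actGen]
    refine LinearMap.ext fun f => funext fun x => ?_
    simp [actVert_apply]
    exact fun h h' => absurd h' h
  | @vertNe v w h =>
    simp only [gvert, map_mul, FreeAlgebra.lift_ι_apply, actGen, map_zero]
    refine LinearMap.ext fun f => funext fun x => ?_
    simp only [Module.End.mul_apply, actVert_apply, LinearMap.zero_apply, Pi.zero_apply]
    by_cases h1 : x.1 = v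
    · rw [if_pos h1, if_neg (h1 ▸ h)]
    · rw [if_neg h1]
  | edgeSource e =>
    simp only [gvert, gedge, map_mul, FreeAlgebra.lift_ι_apply, actGen]
    refine LinearMap.ext fun f => funext fun x => ?_
    simp only [Module.End.mul_apply, actVert_apply]
    rcases key e x with ⟨n, rfl⟩ | h
    · rw [if_pos rfl]
    · rw [actEdge_apply_zero F s r e f x h, ite_self]
  | edgeRange e =>
    simp only [gvert, gedge, map_mul, FreeAlgebra.lift_ι_apply, actGen]
    refine LinearMap.ext fun f => funext fun x => ?_
    simp only [Module.End.mul_apply]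
    rcases key e x with ⟨n, rfl⟩ | h
    · rw [actEdge_apply F s r hφ, actEdge_apply F s r hφ, actVert_apply, if_pos rfl]
    · rw [actEdge_apply_zero F s r e _ x h, actEdge_apply_zero F s r e _ x h]
  | starRange e =>
    simp only [gvert, gstar, map_mul, FreeAlgebra.lift_ι_apply, actGen]
    refine LinearMap.ext fun f => funext fun x => ?_
    simp [actVert_apply, actStar_apply]
    exact fun h h' => absurd h' h
  | starSource e =>
    simp only [gvert, gstar, map_mul, FreeAlgebra.lift_ι_apply, actGen]
    refine LinearMap.ext fun f => funext fun x => ?_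
    simp [actVert_apply, actStar_apply]
  | starEdgeSelf e =>
    simp only [gvert, gstar, gedge, map_mul, FreeAlgebra.lift_ι_apply, actGen]
    refine LinearMap.ext fun f => funext fun x => ?_
    simp only [Module.End.mul_apply, actVert_apply, actStar_apply, actEdge_apply F s r hφ]
    obtain ⟨a, n⟩ := x
    by_cases h : a = r e
    · subst h
      simp
    · simp [h]
  | @starEdgeNe e f h =>
    simp only [gstar, gedge, map_mul, FreeAlgebra.lift_ι_apply, actGen, map_zero]
    refine LinearMap.ext fun g => funext fun x => ?_
    simp only [Module.End.mul_apply, actStar_apply, LinearMap.zero_apply, Pi.zero_apply]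
    rw [actEdge_apply_zero, ite_self]
    intro n hn
    rw [Prod.mk.injEq] at hn
    exact h (hφ e f _ _ hn.1 hn.2).1
  | ck v hfin hne =>
    simp only [gvert, gstar, gedge, map_sum, map_mul, FreeAlgebra.lift_ι_apply, actGen]
    refine LinearMap.ext fun g => funext fun x => ?_
    rw [LinearMap.sum_apply, Finset.sum_apply]
    simp only [Module.End.mul_apply]
    obtain ⟨a, m⟩ := x
    by_cases hav : a = v
    · subst hav
      obtain ⟨e, n, rfl, rfl⟩ := hφ' a hne m
      rw [Finset.sum_eq_single e]
      · rw [actEdge_apply F s r hφ, actStar_apply, actVert_apply, if_pos rfl, if_pos rfl]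
      · intro f _ hfe
        rw [actEdge_apply_zero]
        intro k hk
        rw [Prod.mk.injEq] at hk
        exact hfe (hφ e f _ _ hk.1 hk.2).1.symm
      · intro h
        simp at h
    · rw [actVert_apply, if_neg hav]
      symm
      apply Finset.sum_eq_zero
      intro e he
      rw [actEdge_apply_zero]
      intro k hk
      rw [Prod.mk.injEq] at hk
      simp only [Set.Finite.mem_toFinset, Set.mem_ofPred_eq] at he
      exact hav (hk.1.trans he)

theorem lvert_ne_zero [Finite E] (v : V) : lvert F s r v ≠ 0 := by
  obtain ⟨φ, h1, h2⟩ := exists_branching s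
  intro h
  have h3 := congrArg (RingQuot.liftAlgHom F ⟨FreeAlgebra.lift F (actGen F s r φ),
    actGen_rel F s r h1 h2⟩) h
  rw [lvert, RingQuot.liftAlgHom_mkAlgHom_apply, map_zero, gvert, FreeAlgebra.lift_ι_apply] at h3
  have h4 := congrFun (LinearMap.congr_fun h3 (fun _ => 1)) (v, 0)
  simp [actGen, actVert_apply] at h4

/-! ### Lower bound -/

theorem pathStar_mul_path {a b : V} {p : List E} (h : Pth s r a p b) :
    lpathStar F s r p * (lvert F s r a * lpath F s r p) = lvert F s r b := by
  induction h with
  | nil a => simp [lpath_nil, lpathStar_nil]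
  | @cons e l b h ih =>
    rw [lpathStar_cons, lpath_cons, ← mul_assoc (lvert F s r (s e)), lvert_mul_ledge,
      mul_assoc, ← mul_assoc (lstar F s r e), lstar_mul_ledge, ih]

theorem pathStar_mul_path_zero {a b c : V} {p q : List E} (hp : Pth s r a p b)
    (hq : Pth s r a q c) (h1 : ¬ p <+: q) (h2 : ¬ q <+: p) :
    lpathStar F s r p * (lvert F s r a * lpath F s r q) = 0 := by
  classical
  induction hp generalizing q with
  | nil a => exact absurd List.nil_prefix h1
  | @cons e l b h ih =>
    cases q with
    | nil => exact absurd List.nil_prefix h2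
    | cons f q =>
      have hfe := hq.source_eq
      rw [← hfe, lpathStar_cons, lpath_cons, ← mul_assoc (lvert F s r (s f)), lvert_mul_ledge,
        mul_assoc, ← mul_assoc (lstar F s r e)]
      by_cases hef : e = f
      · subst hef
        rw [lstar_mul_ledge]
        generalize hx : s e = x at hq
        cases hq with
        | cons _ hq =>
          refine ih hq ?_ ?_
          · intro h
            exact h1 (List.cons_prefix_cons.2 ⟨rfl, h⟩)
          · intro h
            exact h2 (List.cons_prefix_cons.2 ⟨rfl, h⟩)
      · rw [lstar_mul_ledge_ne F s r hef, zero_mul, mul_zero]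

theorem eq_of_prefix_cycle {v : V} {p q : List E} (hp : Pth s r v p v) (hq : Pth s r v q v)
    (hp0 : p ≠ []) (hn : (q.map s).Nodup) (h : p <+: q) : p = q := by
  obtain ⟨t, rfl⟩ := h
  cases t with
  | nil => simp
  | cons f t =>
    exfalso
    obtain ⟨b, h1, h2⟩ := hq.split
    cases p with
    | nil => exact hp0 rfl
    | cons e p =>
      have hb : b = v := endsAt_unique (h1.endsAt hp0) (hp.endsAt hp0)
      have e1 := hp.source_eq
      have e2 := h2.source_eq
      rw [hb, ← e1] at e2
      rw [List.cons_append, List.map_cons, List.nodup_cons] at hn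
      apply hn.1
      rw [← e2]
      exact List.mem_map_of_mem (by simp)

/-- Words in two letters. -/
def boolWord {A : Type} [Semiring A] (v : A) (a : Bool → A) : List Bool → A
  | [] => v
  | b :: w => a b * boolWord v a w

/-- Adjoint words in two letters. -/
def boolWordStar {A : Type} [Semiring A] (v : A) (a : Bool → A) : List Bool → A
  | [] => v
  | b :: w => boolWordStar v a w * a b

theorem boolWord_left {A : Type} [Semiring A] {v : A} {a : Bool → A} (hv : v * v = v)
    (ha : ∀ b, v * a b = a b) (w : List Bool) : v * boolWord v a w = boolWord v a w := by
  cases w with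
  | nil => exact hv
  | cons b w => rw [boolWord, ← mul_assoc, ha]

theorem boolWord_orth {A : Type} [Semiring A] {v : A} {a c : Bool → A} (hv : v * v = v)
    (ha : ∀ b, v * a b = a b) (hca : ∀ b, c b * a b = v) (hne : ∀ b b', b ≠ b' → c b * a b' = 0)
    (w w' : List Bool) (hl : w.length = w'.length) :
    boolWordStar v c w * boolWord v a w' = if w = w' then v else 0 := by
  induction w generalizing w' with
  | nil =>
    cases w' with
    | nil => simpa [boolWord, boolWordStar] using hv
    | cons b w' => simp at hl
  | cons b w ih =>
    cases w' with
    | nil => simp at hl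
    | cons b' w' =>
      rw [boolWord, boolWordStar, mul_assoc, ← mul_assoc (c b)]
      by_cases hb : b = b'
      · subst hb
        rw [hca, boolWord_left hv ha, ih w' (by simpa using hl)]
        simp
      · rw [hne b b' hb, zero_mul, mul_zero, if_neg]
        intro h
        exact hb (List.cons.inj h).1

theorem boolWord_mem {A : Type} [Semiring A] [Algebra F A] (W : Submodule F A) {v : A}
    {a : Bool → A} {m : ℕ} (hv : v ∈ powsSum F W m) (ha : ∀ b, a b ∈ powsSum F W m)
    (w : List Bool) : boolWord v a w ∈ powsSum F W (m * (w.length + 1)) := by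
  induction w with
  | nil => simpa [boolWord] using hv
  | cons b w ih =>
    have h := powsSum_mul F W m (m * (w.length + 1)) (Submodule.mul_mem_mul (ha b) ih)
    rw [boolWord, List.length_cons]
    have e : m * (w.length + 1 + 1) = m + m * (w.length + 1) := by ring
    rw [e]
    exact h

theorem two_pow_le_finrank {A : Type} [Ring A] [Algebra F A] (W : Submodule F A)
    (hW : W.FG) {v : A} {a c : Bool → A} {m : ℕ} (hv0 : v ≠ 0) (hv : v * v = v)
    (ha : ∀ b, v * a b = a b) (hca : ∀ b, c b * a b = v) (hne : ∀ b b', b ≠ b' → c b * a b' = 0)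
    (hvm : v ∈ powsSum F W m) (ham : ∀ b, a b ∈ powsSum F W m) (k : ℕ) :
    2 ^ k ≤ Module.finrank F (powsSum F W (m * (k + 1))) := by
  classical
  have : Module.Finite F (powsSum F W (m * (k + 1))) :=
    Module.Finite.iff_fg.2 (powsSum_fg F hW _)
  let x : List.Vector Bool k → powsSum F W (m * (k + 1)) := fun w =>
    ⟨boolWord v a w.1, by
      have := boolWord_mem F W hvm ham w.1
      rwa [w.2] at this⟩
  have hx : LinearIndependent F x := by
    rw [Fintype.linearIndependent_iff]
    intro g hg w
    have h1 : ∑ i, g i • boolWord v a i.1 = 0 := by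
      have := congrArg Subtype.val hg
      simpa [x] using this
    have h2 := congrArg (fun y => boolWordStar v c w.1 * y) h1
    simp only [Finset.mul_sum, mul_zero, mul_smul_comm] at h2
    rw [Finset.sum_eq_single w] at h2
    · rw [boolWord_orth hv ha hca hne _ _ rfl, if_pos rfl] at h2
      exact (smul_eq_zero.1 h2).resolve_right hv0
    · intro w' _ hw
      rw [boolWord_orth hv ha hca hne _ _ (w.2.trans w'.2.symm), if_neg, smul_zero]
      intro h
      exact hw (Subtype.ext h.symm)
    · intro h
      exact absurd (Finset.mem_univ _) h
  have := hx.fintype_card_le_finrank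
  rwa [card_vector, Fintype.card_bool] at this

theorem not_poly_bound (C : ℝ) (d m : ℕ) :
    ∃ k : ℕ, C * ((m * (k + 1) : ℕ) : ℝ) ^ d < 2 ^ k := by
  have h1 := tendsto_pow_const_div_const_pow_of_one_lt d (r := (2 : ℝ)) (by norm_num)
  have h2 := ((Filter.tendsto_add_atTop_iff_nat 1).2 h1).const_mul (2 * (C * (m : ℝ) ^ d))
  rw [mul_zero] at h2
  obtain ⟨k, hk⟩ := (h2.eventually (gt_mem_nhds (zero_lt_one))).exists
  refine ⟨k, ?_⟩
  have h3 : (0 : ℝ) < 2 ^ k := by positivity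
  rw [pow_succ (2 : ℝ) k] at hk
  push_cast at hk ⊢
  rw [mul_pow]
  have e : 2 * (C * (m : ℝ) ^ d) * (((k : ℝ) + 1) ^ d / (2 ^ k * 2)) =
      (C * ((m : ℝ) ^ d * ((k : ℝ) + 1) ^ d)) / 2 ^ k := by
    field_simp
  rw [e, div_lt_one h3] at hk
  exact hk

theorem growth_lower [Finite E] (W : Submodule F (LeavittPathAlgebra F s r)) (hW : W.FG)
    (hgen : ∀ x : LeavittPathAlgebra F s r, ∃ n : ℕ, x ∈ powsSum F W n)
    (C : ℝ) (d : ℕ) (hC : ∀ n : ℕ, 1 ≤ n →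
        (Module.finrank F (powsSum F W n) : ℝ) ≤ C * (n : ℝ) ^ d) :
    SeparatedCycles s r := by
  intro c c' hc hc' ⟨v, hv, hv'⟩
  by_contra hne
  obtain ⟨p, hp0, hp, hpn, hpc⟩ := hc.rotate hv
  obtain ⟨q, hq0, hq, hqn, hqc⟩ := hc'.rotate hv'
  have hpq : p ≠ q := by
    rintro rfl
    apply hne
    ext e
    exact (hpc e).symm.trans (hqc e)
  have h1 : ¬ p <+: q := fun h => hpq (eq_of_prefix_cycle s r hp hq hp0 hqn h)
  have h2 : ¬ q <+: p := fun h => hpq (eq_of_prefix_cycle s r hq hp hq0 hpn h).symm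
  let a : Bool → LeavittPathAlgebra F s r := fun b =>
    lvert F s r v * lpath F s r (if b then p else q)
  let b : Bool → LeavittPathAlgebra F s r := fun b => lpathStar F s r (if b then p else q)
  obtain ⟨m1, hm1⟩ := hgen (lvert F s r v)
  obtain ⟨m2, hm2⟩ := hgen (a true)
  obtain ⟨m3, hm3⟩ := hgen (a false)
  have key := two_pow_le_finrank F W hW (v := lvert F s r v) (a := a) (c := b)
    (m := m1 + m2 + m3 + 1) (lvert_ne_zero F s r v) (lvert_mul_self F s r v)
    (fun i => by simp only [a]; rw [← mul_assoc, lvert_mul_self])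
    (fun i => by
      cases i
      · simpa [a, b] using pathStar_mul_path F s r hq
      · simpa [a, b] using pathStar_mul_path F s r hp)
    (fun i j hij => by
      cases i <;> cases j
      · exact absurd rfl hij
      · simpa [a, b] using pathStar_mul_path_zero F s r hq hp h2 h1
      · simpa [a, b] using pathStar_mul_path_zero F s r hp hq h1 h2
      · exact absurd rfl hij)
    (powsSum_mono F (by omega) hm1)
    (fun i => by
      cases i
      · exact powsSum_mono F (by omega) hm3
      · exact powsSum_mono F (by omega) hm2)
  obtain ⟨k, hk⟩ := not_poly_bound C d (m1 + m2 + m3 + 1)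
  have h3 := hC ((m1 + m2 + m3 + 1) * (k + 1)) (Nat.mul_pos (by omega) (by omega))
  have h4 : ((2 ^ k : ℕ) : ℝ) ≤ _ := Nat.cast_le.2 (key k)
  rw [Nat.cast_pow, Nat.cast_ofNat] at h4
  exact absurd (h4.trans h3) (not_le.2 hk)

/-- Theorem 2(1) of the paper.  For a finite graph `Γ`, the Leavitt
path algebra `L(Γ)` has polynomially bounded growth if and only if any two distinct
cycles of `Γ` have no common vertex. -/
theorem polynomial_growth_iff_separated_cycles
    [Fintype V] [Fintype E]
    (W : Submodule F (LeavittPathAlgebra F s r)) (hfd : FiniteDimensional F W)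
    (hgen : ∀ x : LeavittPathAlgebra F s r, ∃ n : ℕ, x ∈ powsSum F W n) :
    (∃ (C : ℝ) (d : ℕ), ∀ n : ℕ, 1 ≤ n →
        (Module.finrank F (powsSum F W n) : ℝ) ≤ C * (n : ℝ) ^ d) ↔
      SeparatedCycles s r := by
  have hW : W.FG := Module.Finite.iff_fg.1 hfd
  constructor
  · rintro ⟨C, d, h⟩
    exact growth_lower F s r W hW hgen C d h
  · intro hs
    exact growth_upper F s r hs W hW

end LeavittSetup
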